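/- For every μ > 0 and every integer d > 1: for every compact C ⊆ (2^ℕ)^d with □(C) and every continuous F : C → 2^ℕ, there exists a ∈ C^1_μ such that □_*(F^{−1}[a]) holds. (Equivalently, ρ(C^1_μ) = ∞.) -/

import Mathlib

open MeasureTheory Filter Set Topology
open scoped ENNReal

noncomputable section

/-- The Cantor space `2^ℕ`. -/
abbrev Cantor : Type := ℕ → Bool

/-- The uniform product ("fair coin-flipping") probability measure on `2^ℕ`, realized as the
pushforward of Lebesgue measure on `[0,1)` under the binary-digit map. -/
noncomputable def cantorMeasure : Measure Cantor :=
  Measure.map (fun x : ℝ => fun n : ℕ => decide (⌊x * 2 ^ (n + 1)⌋ % 2 = 1))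
    (volume.restrict (Set.Ico (0 : ℝ) 1))

/-- The basic cylinder `[a]` determined by a finite binary sequence `a`. -/
def cyl (a : List Bool) : Set Cantor := {x | ∀ i : Fin a.length, x i = a.get i}

/-- `[A] = ⋃ a ∈ A, [a]`. -/
def cylSet (A : Set (List Bool)) : Set Cantor := ⋃ a ∈ A, cyl a

/-- The weight `2^(-|a|·r)` of a node `a`. -/
noncomputable def wt (r : ℝ) (a : List Bool) : ℝ≥0∞ := (2 : ℝ≥0∞) ^ (-(a.length : ℝ) * r)

/-- `Σ_{a ∈ A} 2^(-|a|·r)`. -/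
noncomputable def wtSum (r : ℝ) (A : Set (List Bool)) : ℝ≥0∞ := ∑' a : A, wt r (a : List Bool)

/-- `A ∈ C^∞_ε`, i.e. `Σ_{a ∈ A} 2^(-|a|·r) ≤ ε`. -/
def memCinf (r ε : ℝ) (A : Set (List Bool)) : Prop := wtSum r A ≤ ENNReal.ofReal ε

/-- The `r`-dimensional dyadic Hausdorff capacity `λ^r_∞`. -/
noncomputable def hcap (r : ℝ) (X : Set Cantor) : ℝ≥0∞ :=
  ⨅ (A : Set (List Bool)) (_ : X ⊆ cylSet A), wtSum r A

/-- `□_δ(X) = inf {λ^r_∞(X \ Z) : Z measurable, λ Z < δ}`. -/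
noncomputable def sqcap (r δ : ℝ) (X : Set Cantor) : ℝ≥0∞ :=
  ⨅ (Z : Set Cantor) (_ : MeasurableSet Z) (_ : cantorMeasure Z < ENNReal.ofReal δ),
    hcap r (X \ Z)

/-- The relation `□_{Θ,Γ}(X)` for `X ⊆ (2^ℕ)^(d+1)` (the index `d` codes dimension `d+1`):
for dimension `1` it says `□_{Θ 0}(X) ≥ Γ 0`, and for dimension `n+2` it says
`□_{Θ (n+1)}({x : □_{Θ,Γ}(X(x,·))}) ≥ Γ (n+1)`, slicing along the first coordinate. -/
def SqTG (r : ℝ) (Θ Γ : ℕ → ℝ) : (d : ℕ) → Set (Fin (d + 1) → Cantor) → Prop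
  | 0, X => ENNReal.ofReal (Γ 0) ≤ sqcap r (Θ 0) {y : Cantor | (fun _ : Fin 1 => y) ∈ X}
  | (n + 1), X => ENNReal.ofReal (Γ (n + 1)) ≤
      sqcap r (Θ (n + 1))
        {x : Cantor | SqTG r Θ Γ n {y : Fin (n + 1) → Cantor | Fin.cons x y ∈ X}}


lemma isOpen_cyl (a : List Bool) : IsOpen (cyl a) := by
  have : cyl a = ⋂ i : Fin a.length, (fun x : Cantor => x i) ⁻¹' {a.get i} := by
    ext x
    simp [cyl]
  rw [this]
  exact isOpen_iInter_of_finite fun i => (isOpen_discrete _).preimage (continuous_apply _)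

lemma isOpen_cylSet (A : Set (List Bool)) : IsOpen (cylSet A) :=
  isOpen_biUnion fun _ _ => isOpen_cyl _

lemma measurable_binaryDigits :
    Measurable (fun x : ℝ => fun n : ℕ => decide (⌊x * 2 ^ (n + 1)⌋ % 2 = 1)) := by
  refine measurable_pi_lambda _ fun n => ?_
  have h : Measurable fun z : ℤ => decide (z % 2 = 1) := measurable_from_top
  exact h.comp (Int.measurable_floor.comp (measurable_id.mul_const _))

instance : IsProbabilityMeasure cantorMeasure := by
  have : IsProbabilityMeasure (volume.restrict (Set.Ico (0 : ℝ) 1)) := ⟨by simp⟩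
  exact Measure.isProbabilityMeasure_map measurable_binaryDigits.aemeasurable

lemma floor_eq_of_binaryDigits_eq {x y : ℝ} (hx : x ∈ Set.Ico (0 : ℝ) 1)
    (hy : y ∈ Set.Ico (0 : ℝ) 1) (n : ℕ)
    (h : ∀ i < n, (⌊x * 2 ^ (i + 1)⌋ % 2 = 1 ↔ ⌊y * 2 ^ (i + 1)⌋ % 2 = 1)) :
    ⌊x * 2 ^ n⌋ = ⌊y * 2 ^ n⌋ := by
  induction n with
  | zero => simp [Int.floor_eq_zero_iff.2 hx, Int.floor_eq_zero_iff.2 hy]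
  | succ n ih =>
    have h0 := ih fun i hi => h i (hi.trans (Nat.lt_succ_self n))
    have h1 := h n (Nat.lt_succ_self n)
    have key : ∀ z : ℝ, ⌊z * 2 ^ (n + 1)⌋ / 2 = ⌊z * 2 ^ n⌋ := by
      intro z
      have := Int.floor_div_natCast (z * 2 ^ (n + 1)) 2
      rw [← Nat.cast_two (R := ℤ), ← this]
      congr 1
      push_cast
      ring
    have hx' := key x
    have hy' := key y
    omega

lemma cantorMeasure_cyl_le (a : List Bool) : cantorMeasure (cyl a) ≤ wt 1 a := by
  rw [cantorMeasure, Measure.map_apply measurable_binaryDigits (isOpen_cyl a).measurableSet,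
    Measure.restrict_apply (measurable_binaryDigits (isOpen_cyl a).measurableSet)]
  set D := (fun x : ℝ => fun n : ℕ => decide (⌊x * 2 ^ (n + 1)⌋ % 2 = 1)) ⁻¹' cyl a ∩
    Set.Ico (0 : ℝ) 1 with hD
  rcases D.eq_empty_or_nonempty with h | ⟨x, hx⟩
  · simp [h]
  have hpow : (0 : ℝ) < 2 ^ a.length := by positivity
  have hsub : D ⊆ Set.Ico ((⌊x * 2 ^ a.length⌋ : ℝ) / 2 ^ a.length)
      ((⌊x * 2 ^ a.length⌋ + 1 : ℝ) / 2 ^ a.length) := by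
    intro y hy
    have hxy : ⌊y * 2 ^ a.length⌋ = ⌊x * 2 ^ a.length⌋ := by
      refine floor_eq_of_binaryDigits_eq hy.2 hx.2 _ fun i hi => ?_
      have h1 : decide _ = _ := hy.1 ⟨i, hi⟩
      have h2 : decide _ = _ := hx.1 ⟨i, hi⟩
      have h3 := h1.trans h2.symm
      simpa using h3
    rw [← hxy, Set.mem_Ico, div_le_iff₀ hpow, lt_div_iff₀ hpow]
    exact ⟨Int.floor_le _, Int.lt_floor_add_one _⟩
  refine (measure_mono hsub).trans ?_
  rw [Real.volume_Ico, ← sub_div, add_sub_cancel_left, wt, mul_one,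
    ENNReal.rpow_neg, ENNReal.rpow_natCast, one_div, ENNReal.ofReal_inv_of_pos hpow,
    ENNReal.ofReal_pow (by norm_num)]
  simp

lemma cantorMeasure_cylSet_le (A : Set (List Bool)) : cantorMeasure (cylSet A) ≤ wtSum 1 A :=
  (measure_biUnion_le _ (Set.to_countable A) _).trans
    (ENNReal.tsum_le_tsum fun _ => cantorMeasure_cyl_le _)

lemma wtSum_mono (r : ℝ) {A B : Set (List Bool)} (h : A ⊆ B) : wtSum r A ≤ wtSum r B :=
  ENNReal.tsum_mono_subtype _ h

/-- Deep nodes of total `r`-weight less than `γ` cover little Lebesgue measure, because `r < 1`. -/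
lemma exists_length_cantorMeasure_le {r : ℝ} (hr1 : r < 1) (γ : ℝ) {η : ℝ} (hη : 0 < η) :
    ∃ M : ℕ, ∀ A : Set (List Bool), wtSum r A < ENNReal.ofReal γ →
      cantorMeasure (cylSet {a ∈ A | M < a.length}) ≤ ENNReal.ofReal η := by
  have hlim : Tendsto (fun M : ℕ => ((2 : ℝ) ^ (-(1 - r))) ^ M * γ) atTop (𝓝 (0 * γ)) := by
    refine (tendsto_pow_atTop_nhds_zero_of_lt_one (by positivity) ?_).mul_const _
    exact Real.rpow_lt_one_of_one_lt_of_neg (by norm_num) (by linarith)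
  rw [zero_mul] at hlim
  obtain ⟨M, hM⟩ := (hlim.eventually (gt_mem_nhds hη)).exists
  refine ⟨M, fun A hA => (cantorMeasure_cylSet_le _).trans ?_⟩
  have hwt : ∀ a : List Bool, M < a.length →
      wt 1 a ≤ ENNReal.ofReal (((2 : ℝ) ^ (-(1 - r))) ^ M) * wt r a := by
    intro a ha
    have e : ∀ s : ℝ, wt s a = ENNReal.ofReal ((2 : ℝ) ^ (-(a.length : ℝ) * s)) := by
      intro s
      rw [wt, ← ENNReal.ofReal_rpow_of_pos (by norm_num)]
      simp
    rw [e, e, ← ENNReal.ofReal_mul (by positivity)]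
    refine ENNReal.ofReal_le_ofReal ?_
    rw [← Real.rpow_mul_natCast (by norm_num), ← Real.rpow_add (by norm_num)]
    refine Real.rpow_le_rpow_of_exponent_le (by norm_num) ?_
    have : (M : ℝ) ≤ a.length := by exact_mod_cast ha.le
    nlinarith
  calc wtSum 1 {a ∈ A | M < a.length}
      ≤ ∑' a : {a ∈ A | M < a.length}, ENNReal.ofReal (((2 : ℝ) ^ (-(1 - r))) ^ M) * wt r a :=
        ENNReal.tsum_le_tsum fun a => hwt a a.2.2
    _ = ENNReal.ofReal (((2 : ℝ) ^ (-(1 - r))) ^ M) * wtSum r {a ∈ A | M < a.length} :=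
        ENNReal.tsum_mul_left
    _ ≤ ENNReal.ofReal (((2 : ℝ) ^ (-(1 - r))) ^ M) * ENNReal.ofReal γ := by
        gcongr
        exact (wtSum_mono r (Set.sep_subset _ _)).trans hA.le
    _ ≤ ENNReal.ofReal η := by
        rw [← ENNReal.ofReal_mul (by positivity)]
        exact ENNReal.ofReal_le_ofReal hM.le

/-- The infimum over measurable exceptional sets can be replaced by outer measure. -/
lemma le_sqcap_iff {r γ δ : ℝ} {X : Set Cantor} :
    ENNReal.ofReal γ ≤ sqcap r δ X ↔ ∀ A, wtSum r A < ENNReal.ofReal γ →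
      ENNReal.ofReal δ ≤ cantorMeasure (X \ cylSet A) := by
  constructor
  · intro h A hA
    by_contra! hlt
    have hsub : X \ toMeasurable cantorMeasure (X \ cylSet A) ⊆ cylSet A := fun x hx => by
      by_contra hxA
      exact hx.2 (subset_toMeasurable _ _ ⟨hx.1, hxA⟩)
    refine absurd h (not_le.2 (lt_of_le_of_lt ?_ hA))
    exact (iInf_le_of_le _ (iInf_le_of_le (measurableSet_toMeasurable _ _)
      (iInf_le_of_le (by rwa [measure_toMeasurable]) (iInf_le_of_le A (iInf_le _ hsub)))))
  · intro h
    refine le_iInf fun Z => le_iInf fun _ => le_iInf fun hZ => le_iInf fun A => le_iInf fun hA => ?_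
    by_contra! hlt
    refine absurd (h A hlt) (not_le.2 (lt_of_le_of_lt (measure_mono ?_) hZ))
    rintro x ⟨hxX, hxA⟩
    by_contra hxZ
    exact hxA (hA ⟨hxX, hxZ⟩)

/-- The relation `□` in dimension `n`, with the nonempty sets as the base case of dimension `0`. -/
def BoxRel (r : ℝ) (Θ Γ : ℕ → ℝ) : (n : ℕ) → Set (Fin n → Cantor) → Prop
  | 0, X => X.Nonempty
  | (n + 1), X => ENNReal.ofReal (Γ n) ≤
      sqcap r (Θ n) {x : Cantor | BoxRel r Θ Γ n {y : Fin n → Cantor | Fin.cons x y ∈ X}}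

lemma sqTG_iff_boxRel (r : ℝ) (Θ Γ : ℕ → ℝ) (n : ℕ) (X : Set (Fin (n + 1) → Cantor)) :
    SqTG r Θ Γ n X ↔ BoxRel r Θ Γ (n + 1) X := by
  induction n with
  | zero =>
    have : {x : Cantor | BoxRel r Θ Γ 0 {y : Fin 0 → Cantor | Fin.cons x y ∈ X}} =
        {y : Cantor | (fun _ : Fin 1 => y) ∈ X} := by
      ext x
      have hc : ∀ y : Fin 0 → Cantor,
          (Fin.cons x y : Fin 1 → Cantor) = fun _ : Fin 1 => x := fun y => by
        funext i
        obtain rfl := Fin.fin_one_eq_zero i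
        rfl
      simp only [BoxRel, Set.mem_ofPred_eq]
      constructor
      · rintro ⟨y, hy⟩
        rw [← hc y]
        exact hy
      · intro h
        refine ⟨Fin.elim0, ?_⟩
        rw [Set.mem_ofPred_eq, hc]
        exact h
    rw [SqTG, BoxRel, this]
  | succ n ih =>
    rw [SqTG, BoxRel]
    simp_rw [ih]

lemma boxRel_congr {r : ℝ} {Θ Θ' Γ : ℕ → ℝ} {n : ℕ} (h : ∀ i < n, Θ i = Θ' i)
    (X : Set (Fin n → Cantor)) : BoxRel r Θ Γ n X ↔ BoxRel r Θ' Γ n X := by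
  induction n with
  | zero => rfl
  | succ n ih =>
    rw [BoxRel, BoxRel, h n n.lt_succ_self]
    simp_rw [ih fun i hi => h i (hi.trans n.lt_succ_self)]

lemma boxRel_mono {r : ℝ} {Θ Γ : ℕ → ℝ} {n : ℕ} {X Y : Set (Fin n → Cantor)} (h : X ⊆ Y)
    (hX : BoxRel r Θ Γ n X) : BoxRel r Θ Γ n Y := by
  induction n with
  | zero => exact Set.Nonempty.mono h hX
  | succ n ih =>
    rw [BoxRel, le_sqcap_iff] at hX ⊢
    intro A hA
    refine (hX A hA).trans (measure_mono (Set.sdiff_subset_sdiff_left fun x hx => ?_))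
    exact ih (fun y hy => h hy) hx

lemma isClosed_le_measure_section {P : Type} [TopologicalSpace P] {E : Set (P × Cantor)}
    (hE : IsClosed E) (c : ℝ≥0∞) : IsClosed {p | c ≤ cantorMeasure {x | (p, x) ∈ E}} := by
  rw [← isOpen_compl_iff, isOpen_iff_mem_nhds]
  intro p hp
  rw [Set.mem_compl_iff, Set.mem_ofPred_eq, not_le] at hp
  obtain ⟨U, hEU, hU, hUc⟩ := Set.exists_isOpen_lt_of_lt _ _ hp
  have hcl : IsClosed (Prod.fst '' (E ∩ Prod.snd ⁻¹' Uᶜ)) :=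
    isClosedMap_fst_of_compactSpace _ (hE.inter (hU.isClosed_compl.preimage continuous_snd))
  refine mem_of_superset (hcl.isOpen_compl.mem_nhds ?_) ?_
  · rintro ⟨⟨q, x⟩, ⟨hqE, hxU⟩, rfl⟩
    exact hxU (hEU hqE)
  · intro q hq
    rw [Set.mem_compl_iff, Set.mem_ofPred_eq, not_le]
    refine lt_of_le_of_lt (measure_mono fun x hx => ?_) hUc
    by_contra hxU
    exact hq ⟨(q, x), ⟨hx, hxU⟩, rfl⟩

lemma isClosed_boxRel_section (r : ℝ) (Θ Γ : ℕ → ℝ) (n : ℕ) {P : Type} [TopologicalSpace P]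
    {D : Set (P × (Fin n → Cantor))} (hD : IsClosed D) :
    IsClosed {p | BoxRel r Θ Γ n {y | (p, y) ∈ D}} := by
  induction n generalizing P with
  | zero =>
    have : {p | BoxRel r Θ Γ 0 {y | (p, y) ∈ D}} =
        (fun p => (p, (Fin.elim0 : Fin 0 → Cantor))) ⁻¹' D := by
      ext p
      constructor
      · rintro ⟨y, hy⟩
        rw [Set.mem_preimage, Subsingleton.elim (Fin.elim0 : Fin 0 → Cantor) y]
        exact hy
      · intro h
        exact ⟨_, h⟩
    rw [this]
    exact hD.preimage (by fun_prop)
  | succ n ih =>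
    set E : Set (P × Cantor) :=
      {q | BoxRel r Θ Γ n {y | (q.1, (Fin.cons q.2 y : Fin (n + 1) → Cantor)) ∈ D}} with hE
    have hEc : IsClosed E := by
      refine ih (P := P × Cantor)
        (D := (fun q : (P × Cantor) × (Fin n → Cantor) =>
          (q.1.1, (Fin.cons q.1.2 q.2 : Fin (n + 1) → Cantor))) ⁻¹' D) ?_
      refine hD.preimage (Continuous.prodMk (by fun_prop) ?_)
      refine continuous_pi fun i => ?_
      refine Fin.cases ?_ (fun j => ?_) i
      · simp only [Fin.cons_zero]; fun_prop
      · simp only [Fin.cons_succ]; fun_prop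
    have : {p | BoxRel r Θ Γ (n + 1) {y | (p, y) ∈ D}} =
        ⋂ (A : Set (List Bool)) (_ : wtSum r A < ENNReal.ofReal (Γ n)),
          {p | ENNReal.ofReal (Θ n) ≤ cantorMeasure {x | (p, x) ∈ E \ Prod.snd ⁻¹' cylSet A}} := by
      ext p
      simp only [BoxRel, le_sqcap_iff, Set.mem_iInter]
      rfl
    rw [this]
    refine isClosed_iInter fun A => isClosed_iInter fun _ => isClosed_le_measure_section ?_ _
    exact hEc.sdiff ((isOpen_cylSet A).preimage continuous_snd)

section RandomSubset

variable {Λ : Type} [Fintype Λ]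

/-- Expectation of `f` at a random subset of `Λ` containing each point independently with
probability `p`. -/
def subsetExp (p : ℝ) (f : Finset Λ → ℝ) : ℝ :=
  ∑ S : Finset Λ, p ^ S.card * (1 - p) ^ (Fintype.card Λ - S.card) * f S

open Classical in
/-- Probability that a random subset of `Λ` satisfies `Q`. -/
def subsetProb (p : ℝ) (Q : Finset Λ → Prop) : ℝ :=
  subsetExp p fun S => if Q S then 1 else 0

lemma subsetExp_const (p c : ℝ) : subsetExp p (fun _ : Finset Λ => c) = c := by
  unfold subsetExp
  rw [← Finset.sum_mul, Fintype.sum_pow_mul_eq_add_pow]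
  simp

lemma subsetExp_mono {p : ℝ} (hp0 : 0 ≤ p) (hp1 : p ≤ 1) {f g : Finset Λ → ℝ}
    (hfg : ∀ S, f S ≤ g S) : subsetExp p f ≤ subsetExp p g := by
  unfold subsetExp
  have : 0 ≤ 1 - p := by linarith
  refine Finset.sum_le_sum fun S _ => mul_le_mul_of_nonneg_left (hfg S) (by positivity)

lemma subsetExp_add (p : ℝ) (f g : Finset Λ → ℝ) :
    subsetExp p (fun S => f S + g S) = subsetExp p f + subsetExp p g := by
  simp [subsetExp, mul_add, Finset.sum_add_distrib]

lemma subsetExp_const_mul (p c : ℝ) (f : Finset Λ → ℝ) :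
    subsetExp p (fun S => c * f S) = c * subsetExp p f := by
  simp only [subsetExp, Finset.mul_sum]
  exact Finset.sum_congr rfl fun S _ => by ring

lemma subsetExp_sum {ι : Type*} (p : ℝ) (s : Finset ι) (f : ι → Finset Λ → ℝ) :
    subsetExp p (fun S => ∑ i ∈ s, f i S) = ∑ i ∈ s, subsetExp p (f i) := by
  simp only [subsetExp, Finset.mul_sum]
  exact Finset.sum_comm

lemma exists_of_subsetProb_add_lt {p : ℝ} (hp0 : 0 ≤ p) (hp1 : p ≤ 1) {Q : Finset Λ → Prop}
    {f : Finset Λ → ℝ} (hf : ∀ S, 0 ≤ f S)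
    (h : subsetProb p (fun S => ¬ Q S) + subsetExp p f < 1) : ∃ S, Q S ∧ f S < 1 := by
  by_contra! hc
  rw [subsetProb, ← subsetExp_add] at h
  refine absurd h (not_lt.2 ?_)
  refine (subsetExp_const (Λ := Λ) p 1).symm.le.trans (subsetExp_mono hp0 hp1 fun S => ?_)
  by_cases hQ : Q S
  · simpa [hQ] using hc S hQ
  · simpa [hQ] using hf S

variable [DecidableEq Λ]

lemma subsetExp_mem (p : ℝ) (a : Λ) (φ : Finset Λ → ℝ) :
    subsetExp p (fun S => if a ∈ S then φ S else 0) = p * subsetExp p (fun S => φ (insert a S)) := by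
  unfold subsetExp
  have hu : (Finset.univ : Finset (Finset Λ)) = (insert a (Finset.univ.erase a)).powerset := by
    rw [Finset.insert_erase (Finset.mem_univ a), Finset.powerset_univ]
  rw [hu, Finset.sum_powerset_insert (Finset.notMem_erase a _),
    Finset.sum_powerset_insert (Finset.notMem_erase a _), ← Finset.sum_add_distrib,
    ← Finset.sum_add_distrib, Finset.mul_sum]
  refine Finset.sum_congr rfl fun S hS => ?_
  have ha : a ∉ S := fun h => Finset.notMem_erase a _ (Finset.mem_powerset.1 hS h)
  have hlt : S.card < Fintype.card Λ := Finset.card_lt_univ_of_notMem ha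
  obtain ⟨c, hc⟩ := Nat.exists_eq_add_of_lt hlt
  have h1 : Fintype.card Λ - S.card = c + 1 := by omega
  have h2 : Fintype.card Λ - (S.card + 1) = c := by omega
  rw [Finset.card_insert_of_notMem ha, h1, h2]
  simp only [ha, if_false, Finset.mem_insert_self, if_true, Finset.insert_idem]
  ring

lemma subsetExp_subset (p : ℝ) (T : Finset Λ) (φ : Finset Λ → ℝ) :
    subsetExp p (fun S => if T ⊆ S then φ S else 0) =
      p ^ T.card * subsetExp p (fun S => φ (S ∪ T)) := by
  induction T using Finset.induction_on generalizing φ with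
  | empty => simp
  | insert a T ha ih =>
    have h1 : (fun S => if insert a T ⊆ S then φ S else 0) =
        fun S => if a ∈ S then (if T ⊆ S then φ S else 0) else 0 := by
      funext S
      by_cases h : a ∈ S <;> simp [Finset.insert_subset_iff, h]
    have h2 : (fun S => if T ⊆ insert a S then φ (insert a S) else 0) =
        fun S => if T ⊆ S then φ (insert a S) else 0 := by
      funext S
      simp [Finset.subset_insert_iff_of_notMem ha]
    rw [h1, subsetExp_mem, h2, ih (fun S => φ (insert a S)), Finset.card_insert_of_notMem ha]
    simp only [Finset.union_insert]
    ring

lemma subsetExp_subset_one (p : ℝ) (T : Finset Λ) :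
    subsetExp p (fun S => if T ⊆ S then (1 : ℝ) else 0) = p ^ T.card := by
  rw [subsetExp_subset, subsetExp_const, mul_one]

lemma subsetExp_card (p : ℝ) :
    subsetExp p (fun S : Finset Λ => (S.card : ℝ)) = p * Fintype.card Λ := by
  have h : (fun S : Finset Λ => (S.card : ℝ)) =
      fun S => ∑ a : Λ, if {a} ⊆ S then (1 : ℝ) else 0 := by
    funext S
    simp
  rw [h, subsetExp_sum]
  simp_rw [subsetExp_subset_one]
  simp [mul_comm]

/-- The second-moment computation: if no point of `Λ` is hit by `T κ` with large weight, the
normalised weight of the `κ` with `T κ ⊆ S` has small variance. -/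
lemma subsetExp_sq_sub_le {K : Type*} [Fintype K] {p ε : ℝ} (hp0 : 0 < p) (hp1 : p ≤ 1)
    (hε0 : 0 ≤ ε) (T : K → Finset Λ) (k : ℕ) (hT : ∀ κ, (T κ).card ≤ k)
    (v : K → ℝ) (hv : ∀ κ, 0 ≤ v κ) (hv1 : ∑ κ, v κ ≤ 1)
    (hε : ∀ s : Λ, ∑ κ, (if s ∈ T κ then v κ else 0) ≤ ε) :
    subsetExp p (fun S => ((∑ κ, v κ * (p ^ (T κ).card)⁻¹ * (if T κ ⊆ S then 1 else 0))
      - ∑ κ, v κ) ^ 2) ≤ (p ^ k)⁻¹ * (ε * k) := by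
  set w := ∑ κ, v κ with hw
  set c : K → ℝ := fun κ => v κ * (p ^ (T κ).card)⁻¹ with hc
  have hcp : ∀ κ, c κ * p ^ (T κ).card = v κ := fun κ => by
    have : p ^ (T κ).card ≠ 0 := by positivity
    simp [hc, this]
  have hpt : ∀ S : Finset Λ, ((∑ κ, c κ * (if T κ ⊆ S then 1 else 0)) - w) ^ 2 =
      (∑ κ, ∑ κ', c κ * c κ' * (if T κ ∪ T κ' ⊆ S then 1 else 0)) +
      ((-2 * w) * (∑ κ, c κ * (if T κ ⊆ S then 1 else 0)) + w ^ 2) := by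
    intro S
    have : (∑ κ, ∑ κ', c κ * c κ' * (if T κ ∪ T κ' ⊆ S then (1 : ℝ) else 0)) =
        (∑ κ, c κ * (if T κ ⊆ S then 1 else 0)) * (∑ κ, c κ * (if T κ ⊆ S then 1 else 0)) := by
      rw [Finset.sum_mul_sum]
      refine Finset.sum_congr rfl fun κ _ => Finset.sum_congr rfl fun κ' _ => ?_
      by_cases h1 : T κ ⊆ S <;> by_cases h2 : T κ' ⊆ S <;>
        simp [Finset.union_subset_iff, h1, h2]
    rw [this]; ring
  have hE1 : subsetExp p (fun S => ∑ κ, c κ * (if T κ ⊆ S then (1 : ℝ) else 0)) = w := by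
    rw [subsetExp_sum]
    simp_rw [subsetExp_const_mul, subsetExp_subset_one, hcp]
    rfl
  have hE2 : subsetExp p
      (fun S => ∑ κ, ∑ κ', c κ * c κ' * (if T κ ∪ T κ' ⊆ S then (1 : ℝ) else 0)) =
      ∑ κ, ∑ κ', c κ * c κ' * p ^ (T κ ∪ T κ').card := by
    rw [subsetExp_sum]
    simp_rw [subsetExp_sum, subsetExp_const_mul, subsetExp_subset_one]
  have hterm : ∀ κ κ', c κ * c κ' * p ^ (T κ ∪ T κ').card ≤ v κ * v κ' +
      (p ^ k)⁻¹ * ∑ s : Λ, (if s ∈ T κ then v κ else 0) * (if s ∈ T κ' then v κ' else 0) := by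
    intro κ κ'
    have hsum0 : ∀ s : Λ, 0 ≤ (if s ∈ T κ then v κ else 0) * (if s ∈ T κ' then v κ' else 0) := by
      intro s
      have := hv κ
      have := hv κ'
      positivity
    have hid : c κ * c κ' * p ^ (T κ ∪ T κ').card =
        v κ * v κ' * (p ^ (T κ ∩ T κ').card)⁻¹ := by
      have hcard := Finset.card_union_add_card_inter (T κ) (T κ')
      have h3 : p ^ (T κ ∪ T κ').card * p ^ (T κ ∩ T κ').card =
          p ^ (T κ).card * p ^ (T κ').card := by
        rw [← pow_add, ← pow_add, hcard]
      rw [← hcp κ, ← hcp κ']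
      field_simp
      linear_combination (c κ * c κ') * h3
    rw [hid]
    rcases (T κ ∩ T κ').eq_empty_or_nonempty with h | ⟨s, hs⟩
    · rw [h]
      have : 0 ≤ (p ^ k)⁻¹ * ∑ s : Λ, (if s ∈ T κ then v κ else 0) *
          (if s ∈ T κ' then v κ' else 0) :=
        mul_nonneg (by positivity) (Finset.sum_nonneg fun s _ => hsum0 s)
      simpa using this
    · have hs' := Finset.mem_inter.1 hs
      have h1 : v κ * v κ' ≤ ∑ s : Λ, (if s ∈ T κ then v κ else 0) *
          (if s ∈ T κ' then v κ' else 0) := by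
        have := Finset.single_le_sum (fun s _ => hsum0 s) (Finset.mem_univ s)
        simpa [hs'.1, hs'.2] using this
      have h2 : (p ^ (T κ ∩ T κ').card)⁻¹ ≤ (p ^ k)⁻¹ := by
        apply inv_anti₀ (by positivity)
        exact pow_le_pow_of_le_one hp0.le hp1
          ((Finset.card_le_card Finset.inter_subset_left).trans (hT κ))
      have h0 : 0 ≤ v κ * v κ' := mul_nonneg (hv κ) (hv κ')
      calc v κ * v κ' * (p ^ (T κ ∩ T κ').card)⁻¹ ≤ v κ * v κ' * (p ^ k)⁻¹ := by gcongr
        _ ≤ (p ^ k)⁻¹ * ∑ s : Λ, (if s ∈ T κ then v κ else 0) *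
          (if s ∈ T κ' then v κ' else 0) := by
            rw [mul_comm]; gcongr
        _ ≤ _ := by linarith
  have hcount : ∑ s : Λ, ∑ κ, (if s ∈ T κ then v κ else 0) ≤ k := by
    rw [Finset.sum_comm]
    calc ∑ κ, ∑ s : Λ, (if s ∈ T κ then v κ else 0) = ∑ κ, (T κ).card * v κ := by
          refine Finset.sum_congr rfl fun κ _ => ?_
          simp
      _ ≤ ∑ κ, k * v κ := by
          refine Finset.sum_le_sum fun κ _ => mul_le_mul_of_nonneg_right ?_ (hv κ)
          exact_mod_cast hT κ
      _ = k * w := by rw [← Finset.mul_sum]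
      _ ≤ k := mul_le_of_le_one_right (by positivity) hv1
  have hnn : ∀ s : Λ, 0 ≤ ∑ κ, (if s ∈ T κ then v κ else 0) := fun s =>
    Finset.sum_nonneg fun κ _ => by have := hv κ; positivity
  have hpairs : ∑ κ, ∑ κ', ∑ s : Λ, (if s ∈ T κ then v κ else 0) *
      (if s ∈ T κ' then v κ' else 0) ≤ ε * k := by
    have h1 : ∑ κ, ∑ κ', ∑ s : Λ, (if s ∈ T κ then v κ else 0) *
        (if s ∈ T κ' then v κ' else 0) =
        ∑ s : Λ, (∑ κ, (if s ∈ T κ then v κ else 0)) *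
          (∑ κ, (if s ∈ T κ then v κ else 0)) := by
      simp_rw [Finset.sum_mul_sum]
      symm
      rw [Finset.sum_comm]
      exact Finset.sum_congr rfl fun κ _ => Finset.sum_comm
    rw [h1]
    calc _ ≤ ∑ s : Λ, ε * (∑ κ, (if s ∈ T κ then v κ else 0)) :=
          Finset.sum_le_sum fun s _ => mul_le_mul_of_nonneg_right (hε s) (hnn s)
        _ = ε * ∑ s : Λ, (∑ κ, (if s ∈ T κ then v κ else 0)) := by rw [Finset.mul_sum]
        _ ≤ ε * k := mul_le_mul_of_nonneg_left hcount hε0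
  have hsq : ∑ κ, ∑ κ', v κ * v κ' = w ^ 2 := by
    rw [hw, sq, Finset.sum_mul_sum]
  calc subsetExp p (fun S => ((∑ κ, c κ * (if T κ ⊆ S then 1 else 0)) - w) ^ 2)
      = ∑ κ, ∑ κ', c κ * c κ' * p ^ (T κ ∪ T κ').card - w ^ 2 := by
        simp_rw [hpt]
        rw [subsetExp_add, subsetExp_add, subsetExp_const_mul, subsetExp_const, hE1, hE2]
        ring
    _ ≤ ∑ κ, ∑ κ', (v κ * v κ' + (p ^ k)⁻¹ * ∑ s : Λ, (if s ∈ T κ then v κ else 0) *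
          (if s ∈ T κ' then v κ' else 0)) - w ^ 2 := by
        gcongr with κ _ κ' _
        exact hterm κ κ'
    _ = (p ^ k)⁻¹ * ∑ κ, ∑ κ', ∑ s : Λ, (if s ∈ T κ then v κ else 0) *
          (if s ∈ T κ' then v κ' else 0) := by
        simp_rw [Finset.sum_add_distrib, hsq, ← Finset.mul_sum]
        ring
    _ ≤ _ := by gcongr


/-- Given weighted `κ : K`, each of which accepts a random set with high probability once the
points of `h κ` are added, there is a bounded `H` such that a random set enlarged by `H` is, with
high probability, accepted by a fixed proportion of the `κ`, measured by any of the weights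
`v j`. -/
lemma exists_bounded_heavy {K J : Type*} [Fintype K] [Fintype J] {p θ ε τ : ℝ}
    (hp0 : 0 < p) (hp1 : p ≤ 1) (hθ : 0 < θ) (hε0 : 0 < ε)
    (acc : K → Finset Λ → Prop) (hacc : ∀ κ S S', S ⊆ S' → acc κ S → acc κ S')
    (h : K → Finset Λ) (k : ℕ) (hk : ∀ κ, (h κ).card ≤ k)
    (v : K → ℝ) (hv : ∀ κ, 0 ≤ v κ) (hv1 : ∑ κ, v κ ≤ 1)
    (hprob : ∀ κ, v κ ≠ 0 → subsetProb p (fun S => ¬ acc κ (S ∪ h κ)) ≤ τ) (hτ : 0 ≤ τ)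
    (u : J → K → ℝ) (hu0 : ∀ j κ, 0 ≤ u j κ) (huv : ∀ j κ, u j κ ≤ v κ)
    (huθ : ∀ j, θ ≤ ∑ κ, u j κ) :
    ∃ H : Finset Λ, (H.card : ℝ) ≤ k / ε ∧
      ∀ Q : Finset Λ → Prop,
        (∀ S, (∀ (j : J) (B : Finset K), (∀ κ, acc κ (S ∪ H) → κ ∈ B) →
          p ^ k * (θ / 4) ≤ ∑ κ ∈ B, u j κ) → Q (S ∪ H)) →
        subsetProb p (fun S => ¬ Q (S ∪ H)) ≤
          4 / θ ^ 2 * (Fintype.card J * ((p ^ k)⁻¹ * (ε * k))) + 4 / θ * τ := by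
  classical
  set H : Finset Λ := Finset.univ.filter fun s => ε < ∑ κ, (if s ∈ h κ then v κ else 0) with hH
  set T : K → Finset Λ := fun κ => h κ \ H with hTdef
  have hTk : ∀ κ, (T κ).card ≤ k := fun κ =>
    (Finset.card_le_card Finset.sdiff_subset).trans (hk κ)
  refine ⟨H, ?_, ?_⟩
  · rw [le_div_iff₀ hε0]
    calc (H.card : ℝ) * ε = ∑ s ∈ H, ε := by simp
      _ ≤ ∑ s ∈ H, ∑ κ, (if s ∈ h κ then v κ else 0) :=
          Finset.sum_le_sum fun s hs => (Finset.mem_filter.1 hs).2.le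
      _ ≤ ∑ s : Λ, ∑ κ, (if s ∈ h κ then v κ else 0) :=
          Finset.sum_le_sum_of_subset_of_nonneg (Finset.subset_univ _) fun s _ _ =>
            Finset.sum_nonneg fun κ _ => by have := hv κ; positivity
      _ = ∑ κ, (h κ).card * v κ := by
          rw [Finset.sum_comm]
          refine Finset.sum_congr rfl fun κ _ => ?_
          simp
      _ ≤ ∑ κ, k * v κ := by
          refine Finset.sum_le_sum fun κ _ => mul_le_mul_of_nonneg_right ?_ (hv κ)
          exact_mod_cast hk κ
      _ = k * ∑ κ, v κ := by rw [← Finset.mul_sum]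
      _ ≤ k := mul_le_of_le_one_right (by positivity) hv1
  · intro Q hQ
    have hinv : ∀ κ, 0 ≤ (p ^ (T κ).card)⁻¹ := fun κ => by positivity
    set W : J → Finset Λ → ℝ := fun j S =>
      ∑ κ, u j κ * (p ^ (T κ).card)⁻¹ * (if T κ ⊆ S then 1 else 0) with hW
    set V : Finset Λ → ℝ := fun S => ∑ κ, v κ * (p ^ (T κ).card)⁻¹ *
      (if T κ ⊆ S then (if acc κ (S ∪ H) then 0 else 1) else 0) with hV
    have hV0 : ∀ S, 0 ≤ V S := fun S => Finset.sum_nonneg fun κ _ => by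
      have := hv κ
      have := hinv κ
      positivity
    have hvar : ∀ j, subsetExp p (fun S => (W j S - ∑ κ, u j κ) ^ 2) ≤ (p ^ k)⁻¹ * (ε * k) := by
      intro j
      refine subsetExp_sq_sub_le hp0 hp1 hε0.le T k hTk (u j) (hu0 j)
        ((Finset.sum_le_sum fun κ _ => huv j κ).trans hv1) ?_
      intro s
      by_cases hs : s ∈ H
      · simp [hTdef, hs, hε0.le]
      · have hs' : ∑ κ, (if s ∈ h κ then v κ else 0) ≤ ε := by
          simpa [hH] using hs
        refine le_trans (Finset.sum_le_sum fun κ _ => ?_) hs'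
        by_cases hsκ : s ∈ h κ <;> simp [hTdef, hs, hsκ, huv j κ]
    have hbad : subsetExp p V ≤ τ := by
      rw [hV, subsetExp_sum]
      refine le_trans (Finset.sum_le_sum fun κ _ => (?_ : _ ≤ v κ * τ)) ?_
      · rw [subsetExp_const_mul, subsetExp_subset]
        have hpp : p ^ (T κ).card ≠ 0 := by positivity
        rw [mul_assoc, inv_mul_cancel_left₀ hpp]
        by_cases h0 : v κ = 0
        · simp [h0]
        refine mul_le_mul_of_nonneg_left (le_trans ?_ (hprob κ h0)) (hv κ)
        refine subsetExp_mono hp0.le hp1 fun S => ?_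
        have hsub : S ∪ h κ ⊆ S ∪ T κ ∪ H := by
          intro s hs
          by_cases hsH : s ∈ H
          · simp [hsH]
          · simpa [hTdef, hsH] using hs
        by_cases ha : acc κ (S ∪ h κ)
        · have ha' := hacc κ _ _ hsub ha
          simp only [ha, ha', not_true_eq_false, if_true, if_false, le_refl]
        · simp only [ha, not_false_eq_true, if_true]
          split_ifs <;> norm_num
      · rw [← Finset.sum_mul]
        exact mul_le_of_le_one_left hτ hv1
    have hgood : ∀ S, V S < θ / 4 → (∀ j, (W j S - ∑ κ, u j κ) ^ 2 < (θ / 2) ^ 2) →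
        Q (S ∪ H) := by
      intro S hVS hWS
      refine hQ S fun j B hB => ?_
      have h1 := (abs_lt_of_sq_lt_sq' (hWS j) (by positivity)).1
      have h2 : W j S ≤ V S + (p ^ k)⁻¹ * ∑ κ ∈ B, u j κ := by
        have hB' : ∑ κ ∈ B, u j κ = ∑ κ, if κ ∈ B then u j κ else 0 := by simp
        rw [hB', Finset.mul_sum, ← Finset.sum_add_distrib]
        refine Finset.sum_le_sum fun κ _ => ?_
        have hle : (p ^ (T κ).card)⁻¹ ≤ (p ^ k)⁻¹ :=
          inv_anti₀ (by positivity) (pow_le_pow_of_le_one hp0.le hp1 (hTk κ))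
        have h5 : u j κ * (p ^ (T κ).card)⁻¹ ≤ (p ^ k)⁻¹ * u j κ := by
          rw [mul_comm]
          exact mul_le_mul_of_nonneg_right hle (hu0 j κ)
        have h6 : u j κ * (p ^ (T κ).card)⁻¹ ≤ v κ * (p ^ (T κ).card)⁻¹ :=
          mul_le_mul_of_nonneg_right (huv j κ) (hinv κ)
        have h7 : 0 ≤ u j κ * (p ^ (T κ).card)⁻¹ := mul_nonneg (hu0 j κ) (hinv κ)
        by_cases hTS : T κ ⊆ S
        · by_cases ha : acc κ (S ∪ H)
          · simp [hTS, ha, hB κ ha, h5]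
          · by_cases hb : κ ∈ B
            · simp only [hTS, ha, hb, if_true, if_false, mul_one]
              linarith
            · simp [hTS, ha, hb, h6]
        · by_cases hb : κ ∈ B
          · simp only [hTS, hb, if_true, if_false, mul_zero, zero_add]
            linarith
          · simp [hTS, hb]
      have h3 := huθ j
      have h4 : θ / 4 ≤ (p ^ k)⁻¹ * ∑ κ ∈ B, u j κ := by linarith
      have hpk : (0 : ℝ) < p ^ k := by positivity
      calc p ^ k * (θ / 4) ≤ p ^ k * ((p ^ k)⁻¹ * ∑ κ ∈ B, u j κ) := by gcongr
        _ = _ := by rw [mul_inv_cancel_left₀ hpk.ne']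
    calc subsetProb p (fun S => ¬ Q (S ∪ H))
        ≤ subsetExp p (fun S => 4 / θ ^ 2 * (∑ j, (W j S - ∑ κ, u j κ) ^ 2) + 4 / θ * V S) := by
          refine subsetExp_mono hp0.le hp1 fun S => ?_
          have hs0 : 0 ≤ ∑ j, (W j S - ∑ κ, u j κ) ^ 2 :=
            Finset.sum_nonneg fun j _ => sq_nonneg _
          have hV0S := hV0 S
          by_cases hq : Q (S ∪ H)
          · simp only [hq, not_true_eq_false, if_false]
            positivity
          simp only [hq, not_false_eq_true, if_true]
          by_cases hVS : V S < θ / 4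
          · obtain ⟨j, hj⟩ : ∃ j, (θ / 2) ^ 2 ≤ (W j S - ∑ κ, u j κ) ^ 2 := by
              by_contra! hc
              exact hq (hgood S hVS hc)
            have hj' := hj.trans (Finset.single_le_sum
              (f := fun j => (W j S - ∑ κ, u j κ) ^ 2) (fun j _ => sq_nonneg _)
              (Finset.mem_univ j))
            calc (1 : ℝ) = 4 / θ ^ 2 * (θ / 2) ^ 2 := by field_simp; norm_num
              _ ≤ 4 / θ ^ 2 * (∑ j, (W j S - ∑ κ, u j κ) ^ 2) := by gcongr
              _ ≤ _ := by
                  have : 0 ≤ 4 / θ * V S := by positivity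
                  linarith
          · calc (1 : ℝ) = 4 / θ * (θ / 4) := by field_simp
              _ ≤ 4 / θ * V S := by gcongr; exact not_lt.1 hVS
              _ ≤ _ := by
                  have : 0 ≤ 4 / θ ^ 2 * ∑ j, (W j S - ∑ κ, u j κ) ^ 2 := by positivity
                  linarith
      _ = 4 / θ ^ 2 * (∑ j, subsetExp p (fun S => (W j S - ∑ κ, u j κ) ^ 2)) +
            4 / θ * subsetExp p V := by
          rw [subsetExp_add, subsetExp_const_mul, subsetExp_const_mul, subsetExp_sum]
      _ ≤ 4 / θ ^ 2 * (∑ _j : J, (p ^ k)⁻¹ * (ε * k)) + 4 / θ * τ := by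
          gcongr with j _
          exact hvar j
      _ = _ := by simp

end RandomSubset

/-- One coordinate: if every point of `G` lies in `GS` of a random set enlarged by a bounded set
depending on the point, then one bounded set works for a large part of `G` at once. -/
lemma exists_bounded_enlargement {r γ θ p τ : ℝ} (hr1 : r < 1) (hθ : 0 < θ) (hp0 : 0 < p)
    (hp1 : p ≤ 1) (hτ : 0 < τ) :
    ∃ τ₀ > 0, ∀ k : ℕ, ∃ η > 0, ∃ k' : ℕ, ∀ (Λ : Type) [Fintype Λ] [DecidableEq Λ]
      (G : Set Cantor) (GS : Finset Λ → Set Cantor), MeasurableSet G →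
      (∀ S, MeasurableSet (GS S)) → Monotone GS → ENNReal.ofReal γ ≤ sqcap r θ G →
      (∀ x ∈ G, ∃ h : Finset Λ, h.card ≤ k ∧ subsetProb p (fun S => ¬ x ∈ GS (S ∪ h)) ≤ τ₀) →
      ∃ H : Finset Λ, H.card ≤ k' ∧
        subsetProb p (fun S => ¬ ENNReal.ofReal γ ≤ sqcap r η (GS (S ∪ H))) ≤ τ := by
  classical
  refine ⟨θ * τ / 8, by positivity, fun k => ?_⟩
  set η : ℝ := p ^ k * (θ / 8) with hη
  have hη0 : 0 < η := by positivity
  obtain ⟨M, hM⟩ := exists_length_cantorMeasure_le hr1 γ hη0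
  have hfin : {B : Set (List Bool) | B ⊆ {a | a.length ≤ M} ∧
      wtSum r B < ENNReal.ofReal γ}.Finite :=
    (List.finite_length_le Bool M).finite_subsets.subset fun B hB => hB.1
  set J := {B : Set (List Bool) // B ⊆ {a | a.length ≤ M} ∧ wtSum r B < ENNReal.ofReal γ} with hJ
  have : Finite J := hfin
  have : Fintype J := Fintype.ofFinite J
  set n := Fintype.card J with hn
  set ε : ℝ := τ * θ ^ 2 * p ^ k / (8 * (n * k + 1)) with hε
  have hε0 : 0 < ε := by positivity
  refine ⟨η, hη0, ⌊(k : ℝ) / ε⌋₊, ?_⟩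
  intro Λ _ _ G GS hG hGS hmono hsq hh
  let κ : Cantor → Set (Finset Λ) := fun x => {S | x ∈ GS S}
  have hκm : ∀ c, MeasurableSet (κ ⁻¹' {c}) := by
    intro c
    have : κ ⁻¹' {c} = ⋂ S, (if S ∈ c then GS S else (GS S)ᶜ) := by
      ext x
      simp only [Set.mem_preimage, Set.mem_singleton_iff, Set.mem_iInter, κ, Set.ext_iff]
      refine forall_congr' fun S => ?_
      by_cases hS : S ∈ c <;> simp [hS]
    rw [this]
    refine MeasurableSet.iInter fun S => ?_
    split_ifs
    · exact hGS S
    · exact (hGS S).compl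
  have hfiber : ∀ (Y : Set Cantor) (B : Finset (Set (Finset Λ))), MeasurableSet Y →
      ∑ c ∈ B, cantorMeasure.real (Y ∩ κ ⁻¹' {c}) = cantorMeasure.real (Y ∩ κ ⁻¹' B) := by
    intro Y B hY
    rw [← measureReal_biUnion_finset]
    · congr 1
      ext x
      simp
    · intro c _ c' _ hcc
      refine Set.disjoint_left.2 ?_
      rintro x ⟨-, rfl⟩ ⟨-, hx⟩
      exact hcc hx
    · exact fun c _ => hY.inter (hκm c)
  have hchoice : ∀ c : Set (Finset Λ), ∃ h : Finset Λ, h.card ≤ k ∧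
      ((∃ x ∈ G, κ x = c) → ∃ x ∈ G, κ x = c ∧
        subsetProb p (fun S => ¬ x ∈ GS (S ∪ h)) ≤ θ * τ / 8) := by
    intro c
    by_cases hc : ∃ x ∈ G, κ x = c
    · obtain ⟨x, hx, hxc⟩ := hc
      obtain ⟨h, h1, h2⟩ := hh x hx
      exact ⟨h, h1, fun _ => ⟨x, hx, hxc, h2⟩⟩
    · exact ⟨∅, by simp, fun h => absurd h hc⟩
  choose h hk hprob using hchoice
  let acc : Set (Finset Λ) → Finset Λ → Prop := fun c S => ∃ S' ⊆ S, S' ∈ c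
  have hacc : ∀ x S, acc (κ x) S ↔ x ∈ GS S := fun x S =>
    ⟨fun ⟨S', hS', hx⟩ => hmono hS' hx, fun hx => ⟨S, subset_rfl, hx⟩⟩
  have hmeas : ∀ j : J, MeasurableSet (G \ cylSet j.1) := fun j =>
    hG.diff (isOpen_cylSet _).measurableSet
  obtain ⟨H, hH, hQ⟩ := exists_bounded_heavy (K := Set (Finset Λ)) (J := J) (τ := θ * τ / 8)
    hp0 hp1 hθ hε0 acc (fun c S S' hS ⟨S₀, h1, h2⟩ => ⟨S₀, h1.trans hS, h2⟩) h k hk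
    (fun c => cantorMeasure.real (G ∩ κ ⁻¹' {c})) (fun c => measureReal_nonneg)
    (by rw [hfiber G _ hG]; exact measureReal_le_one)
    (by
      intro c hc
      have hne : ∃ x ∈ G, κ x = c := by
        by_contra! hno
        refine hc ?_
        have : G ∩ κ ⁻¹' {c} = ∅ := by
          ext x
          simp only [Set.mem_inter_iff, Set.mem_preimage, Set.mem_singleton_iff,
            Set.mem_empty_iff_false, iff_false, not_and]
          exact hno x
        simp [this]
      obtain ⟨x, -, hxc, hx⟩ := hprob c hne
      subst hxc
      simpa only [hacc] using hx)
    (by positivity)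
    (fun (j : J) c => cantorMeasure.real ((G \ cylSet j.1) ∩ κ ⁻¹' {c}))
    (fun _ _ => measureReal_nonneg)
    (fun j c => measureReal_mono (Set.inter_subset_inter_left _ Set.sdiff_subset))
    (by
      intro j
      rw [hfiber _ _ (hmeas j)]
      have h1 := le_sqcap_iff.1 hsq j.1 j.2.2
      have h2 := (ENNReal.ofReal_le_iff_le_toReal (measure_ne_top _ _)).1 h1
      simpa [Measure.real] using h2)
  refine ⟨H, Nat.le_floor hH, (hQ (fun S => ENNReal.ofReal γ ≤ sqcap r η (GS S)) ?_).trans ?_⟩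
  · intro S hS
    rw [le_sqcap_iff]
    intro A hA
    set B : Set (List Bool) := {a ∈ A | a.length ≤ M} with hB
    have hBJ : B ⊆ {a | a.length ≤ M} ∧ wtSum r B < ENNReal.ofReal γ :=
      ⟨fun a ha => ha.2, (wtSum_mono r (Set.sep_subset _ _)).trans_lt hA⟩
    have h1 := hS ⟨B, hBJ⟩ (Finset.univ.filter fun c => acc c (S ∪ H)) (by simp)
    rw [hfiber _ _ (hmeas ⟨B, hBJ⟩)] at h1
    have h2 : cantorMeasure.real ((G \ cylSet B) ∩ κ ⁻¹'
        ((Finset.univ.filter fun c => acc c (S ∪ H) : Finset (Set (Finset Λ))) :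
          Set (Set (Finset Λ)))) ≤
        cantorMeasure.real ((GS (S ∪ H) \ cylSet A) ∪ cylSet {a ∈ A | M < a.length}) := by
      refine measureReal_mono ?_
      rintro x ⟨⟨-, hxB⟩, hx⟩
      have hx' : x ∈ GS (S ∪ H) := by
        rw [← hacc]
        simpa using hx
      by_cases hxA : x ∈ cylSet A
      · right
        simp only [cylSet, Set.mem_iUnion] at hxA hxB ⊢
        obtain ⟨a, ha, hxa⟩ := hxA
        refine ⟨a, ⟨ha, ?_⟩, hxa⟩
        by_contra hlen
        exact hxB ⟨a, ⟨ha, not_lt.1 hlen⟩, hxa⟩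
      · exact Or.inl ⟨hx', hxA⟩
    have h3 : cantorMeasure.real (cylSet {a ∈ A | M < a.length}) ≤ η :=
      ENNReal.toReal_le_of_le_ofReal hη0.le (hM A hA)
    have h4 := measureReal_union_le (μ := cantorMeasure) (GS (S ∪ H) \ cylSet A)
      (cylSet {a ∈ A | M < a.length})
    have h5 : η ≤ cantorMeasure.real (GS (S ∪ H) \ cylSet A) := by
      have : p ^ k * (θ / 4) = η + η := by rw [hη]; ring
      linarith
    exact (ENNReal.ofReal_le_iff_le_toReal (measure_ne_top _ _)).2 h5
  · have e1 : 4 / θ * (θ * τ / 8) = τ / 2 := by field_simp; norm_num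
    have e2 : 4 / θ ^ 2 * (n * ((p ^ k)⁻¹ * (ε * k))) = τ / 2 * (n * k / (n * k + 1)) := by
      rw [hε]
      field_simp
      ring
    have e3 : (n * k / (n * k + 1) : ℝ) ≤ 1 := by
      rw [div_le_one (by positivity)]
      linarith
    rw [e1, e2]
    nlinarith

/-- If `C` is large and its points are coloured by a finite set `Λ`, then the points whose colour
lies in a random set of colours, enlarged by a bounded set `h`, are still large with high
probability. The bound on `h` and the thresholds `η` depend neither on `Λ` nor on `C`. -/
theorem exists_bounded_boxRel {r p : ℝ} {Θ Γ : ℕ → ℝ} (hr1 : r < 1) (hΘ : ∀ i, 0 < Θ i)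
    (hp0 : 0 < p) (hp1 : p ≤ 1) (n : ℕ) :
    ∀ τ > 0, ∃ η : ℕ → ℝ, (∀ i, 0 < η i) ∧ ∃ k : ℕ, ∀ (Λ : Type) [Fintype Λ] [DecidableEq Λ]
      (C : Set (Fin n → Cantor)) (F : (Fin n → Cantor) → Λ), IsClosed C →
      (∀ s, IsClosed (C ∩ F ⁻¹' {s})) → BoxRel r Θ Γ n C →
      ∃ h : Finset Λ, h.card ≤ k ∧
        subsetProb p (fun S => ¬ BoxRel r η Γ n
          (C ∩ F ⁻¹' ((S ∪ h : Finset Λ) : Set Λ))) ≤ τ := by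
  induction n with
  | zero =>
    intro τ hτ
    refine ⟨fun _ => 1, fun _ => one_pos, 1, ?_⟩
    rintro Λ _ _ C F - - ⟨y, hy⟩
    refine ⟨{F y}, by simp, ?_⟩
    have : ∀ S : Finset Λ, BoxRel r (fun _ => 1) Γ 0
        (C ∩ F ⁻¹' ((S ∪ {F y} : Finset Λ) : Set Λ)) := fun S => ⟨y, hy, by simp⟩
    simp only [subsetProb, this, not_true_eq_false, if_false, subsetExp_const]
    exact hτ.le
  | succ n ih =>
    intro τ hτ
    obtain ⟨τ₀, hτ₀, hstep⟩ := exists_bounded_enlargement (γ := Γ n) hr1 (hΘ n) hp0 hp1 hτ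
    obtain ⟨η', hη', k, hk⟩ := ih τ₀ hτ₀
    obtain ⟨ηn, hηn, k', hk'⟩ := hstep k
    refine ⟨Function.update η' n ηn, fun i => ?_, k', ?_⟩
    · by_cases hi : i = n
      · subst hi; simpa using hηn
      · simpa [hi] using hη' i
    intro Λ _ _ C F hC hF hbox
    have hcons : Continuous fun q : Cantor × (Fin n → Cantor) =>
        (Fin.cons q.1 q.2 : Fin (n + 1) → Cantor) := by
      refine continuous_pi fun i => ?_
      refine Fin.cases ?_ (fun j => ?_) i
      · simp only [Fin.cons_zero]; fun_prop
      · simp only [Fin.cons_succ]; fun_prop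
    have hFS : ∀ S : Finset Λ, IsClosed (C ∩ F ⁻¹' (S : Set Λ)) := by
      intro S
      have : C ∩ F ⁻¹' (S : Set Λ) = ⋃ s ∈ S, C ∩ F ⁻¹' {s} := by
        ext y; simp
      rw [this]
      exact S.finite_toSet.isClosed_biUnion fun s _ => hF s
    obtain ⟨H, hH, hHp⟩ := hk' Λ
      {x | BoxRel r Θ Γ n {y : Fin n → Cantor | (Fin.cons x y : Fin (n + 1) → Cantor) ∈ C}}
      (fun S => {x | BoxRel r η' Γ n
        {y : Fin n → Cantor | (Fin.cons x y : Fin (n + 1) → Cantor) ∈ C ∩ F ⁻¹' (S : Set Λ)}})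
      (isClosed_boxRel_section r Θ Γ n (hC.preimage hcons)).measurableSet
      (fun S => (isClosed_boxRel_section r η' Γ n ((hFS S).preimage hcons)).measurableSet)
      (fun S S' hS x hx => boxRel_mono (fun y hy => ⟨hy.1, hS hy.2⟩) hx) hbox
      (fun x hx => hk Λ {y : Fin n → Cantor | (Fin.cons x y : Fin (n + 1) → Cantor) ∈ C}
        (fun y => F (Fin.cons x y : Fin (n + 1) → Cantor))
        (hC.preimage (hcons.comp (Continuous.prodMk_right x)))
        (fun s => (hF s).preimage (hcons.comp (Continuous.prodMk_right x))) hx)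
    refine ⟨H, hH, ?_⟩
    have hc : ∀ X : Set (Fin n → Cantor),
        BoxRel r (Function.update η' n ηn) Γ n X ↔ BoxRel r η' Γ n X :=
      boxRel_congr fun i hi => Function.update_of_ne hi.ne ηn η'
    simpa only [BoxRel, Function.update_self, hc] using hHp

lemma mem_cyl_ofFn {m : ℕ} (s : Fin m → Bool) (x : Cantor) :
    x ∈ cyl (List.ofFn s) ↔ (fun i : Fin m => x i) = s := by
  simp only [cyl, Set.mem_ofPred_eq, List.get_ofFn]
  constructor
  · intro h
    funext i
    simpa using h (Fin.cast (List.length_ofFn).symm i)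
  · intro h i
    subst h
    simp

lemma mem_cylSet_image_ofFn {m : ℕ} (S : Finset (Fin m → Bool)) (x : Cantor) :
    x ∈ cylSet (List.ofFn '' (S : Set (Fin m → Bool))) ↔ (fun i : Fin m => x i) ∈ S := by
  simp only [cylSet, Set.biUnion_image, Set.mem_iUnion, mem_cyl_ofFn]
  simp

lemma wtSum_image_ofFn_le {m : ℕ} (S : Finset (Fin m → Bool)) :
    wtSum 1 (List.ofFn '' (S : Set (Fin m → Bool))) ≤ ENNReal.ofReal (S.card / 2 ^ m) := by
  have hinj : Set.InjOn (List.ofFn (n := m) (α := Bool)) S := List.ofFn_injective.injOn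
  rw [wtSum, tsum_image (f := fun a => wt 1 a) hinj]
  simp only [wt, List.length_ofFn, mul_one]
  rw [ENNReal.tsum_const, ENNReal.rpow_neg, ENNReal.rpow_natCast, div_eq_mul_inv,
    ENNReal.ofReal_mul (by positivity), ENNReal.ofReal_inv_of_pos (by positivity),
    ENNReal.ofReal_pow (by norm_num)]
  simp

/-- here `d = e + 2 > 1`. -/
theorem statement8 (r : ℝ) (hr0 : 0 < r) (hr1 : r < 1)
    (Θ Γ : ℕ → ℝ) (hΘpos : ∀ i, 0 < Θ i) (hΓpos : ∀ i, 0 < Γ i)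
    (hΘanti : StrictAnti Θ) (hΘlim : Filter.Tendsto Θ Filter.atTop (nhds 0))
    (hΘΓ : ∀ j, Θ j + Γ j < 1) (hΘΓsucc : ∀ j, Θ j + Γ (j + 1) < 1)
    (hΓdense : ∀ x ∈ Set.Ioo (0 : ℝ) 1, x ∈ closure (Set.range Γ))
    (μ₀ : ℝ) (hμ : 0 < μ₀) (e : ℕ)
    (C : Set (Fin (e + 2) → Cantor)) (hCcomp : IsCompact C)
    (hC : SqTG r Θ Γ (e + 1) C)
    (F : (Fin (e + 2) → Cantor) → Cantor) (hFcont : ContinuousOn F C) :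
    ∃ a : Set (List Bool), memCinf 1 μ₀ a ∧
      ∃ η : ℕ → ℝ, (∀ i, 0 < η i) ∧ SqTG r η Γ (e + 1) (C ∩ F ⁻¹' cylSet a) := by
  set p : ℝ := min (μ₀ / 8) 1 with hp
  have hp0 : 0 < p := lt_min (by positivity) one_pos
  have hp1 : p ≤ 1 := min_le_right _ _
  obtain ⟨η, hη, k, hk⟩ := exists_bounded_boxRel (Γ := Γ) hr1 hΘpos hp0 hp1 (e + 2) (1 / 2)
    (by norm_num)
  obtain ⟨m, hm⟩ := pow_unbounded_of_one_lt (2 * k / μ₀) (one_lt_two (α := ℝ))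
  let π : Cantor → (Fin m → Bool) := fun x i => x i
  have hπ : Continuous π := by fun_prop
  obtain ⟨h, hhk, hprob⟩ := hk (Fin m → Bool) C (fun z => π (F z)) hCcomp.isClosed
    (fun s => (hπ.comp_continuousOn hFcont).preimage_isClosed_of_isClosed hCcomp.isClosed
      (isClosed_singleton (x := s))) ((sqTG_iff_boxRel _ _ _ _ _).1 hC)
  have h2m : (0 : ℝ) < 2 ^ m := by positivity
  obtain ⟨S, hbox, hS⟩ := exists_of_subsetProb_add_lt (p := p) hp0.le hp1
    (Q := fun S => BoxRel r η Γ (e + 2) (C ∩ (fun z => π (F z)) ⁻¹'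
      ((S ∪ h : Finset (Fin m → Bool)) : Set (Fin m → Bool))))
    (f := fun S => 2 / (μ₀ * 2 ^ m) * (S.card : ℝ)) (fun S => by positivity) (by
      rw [subsetExp_const_mul, subsetExp_card]
      have h1 : 2 / (μ₀ * 2 ^ m) * (p * (Fintype.card (Fin m → Bool) : ℝ)) ≤ 1 / 4 := by
        have : p ≤ μ₀ / 8 := min_le_left _ _
        simp only [Fintype.card_pi, Fintype.card_bool, Finset.prod_const, Finset.card_univ,
          Fintype.card_fin]
        push_cast
        calc 2 / (μ₀ * 2 ^ m) * (p * 2 ^ m) ≤ 2 / (μ₀ * 2 ^ m) * (μ₀ / 8 * 2 ^ m) := by gcongr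
          _ = 1 / 4 := by field_simp; norm_num
      linarith)
  have hScard : (S.card : ℝ) ≤ μ₀ / 2 * 2 ^ m := by
    rw [div_mul_eq_mul_div, div_lt_one (by positivity)] at hS
    linarith
  have hkm : (k : ℝ) ≤ μ₀ / 2 * 2 ^ m := by
    rw [div_lt_iff₀ hμ] at hm
    linarith
  refine ⟨List.ofFn '' ((S ∪ h : Finset (Fin m → Bool)) : Set (Fin m → Bool)), ?_, η, hη, ?_⟩
  · refine (wtSum_image_ofFn_le _).trans (ENNReal.ofReal_le_ofReal ?_)
    rw [div_le_iff₀ h2m]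
    have h1 : ((S ∪ h).card : ℝ) ≤ S.card + h.card := by exact_mod_cast Finset.card_union_le S h
    have h2 : (h.card : ℝ) ≤ k := by exact_mod_cast hhk
    linarith
  · rw [sqTG_iff_boxRel]
    convert hbox using 2
    ext z
    exact mem_cylSet_image_ofFn _ _
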